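/- arXiv:1907.01449 — 3 statements merged into one kernel-verified Lean document; each statement's English description precedes it below -/
import Mathlib

section
/- Let q be a prime power and F_q a finite field with q elements. There exist real numbers B > 0 and C with 0 < C < q such that for every positive integer n, every α, β, γ ∈ F_q with γ ≠ 0 and α + β + γ = 0, and every finite set A ⊆ F_q^n such that the only solutions of α·a₁ + β·a₂ + γ·a₃ = 0 with a₁, a₂, a₃ ∈ A are those with a₁ = a₂ = a₃, one has |A| ≤ B·C^n. -/
/-- A subspace of functions on a finite set contains a function whose support is at least as large
as the dimension of the subspace. -/
theorem Submodule.exists_finrank_le_card_support {F X : Type*} [Field F] [Fintype X]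
    [DecidableEq F] (V : Submodule F (X → F)) :
    ∃ v ∈ V, Module.finrank F V ≤ (Finset.univ.filter fun x => v x ≠ 0).card := by
  obtain ⟨S, ⟨v, hv, rfl⟩, hmax⟩ := Set.Finite.exists_maximalFor Finset.card
    {S : Finset X | ∃ v ∈ V, (Finset.univ.filter fun x => v x ≠ 0) = S} (Set.toFinite _)
    ⟨_, 0, V.zero_mem, rfl⟩
  refine ⟨v, hv, ?_⟩
  set S := Finset.univ.filter fun x => v x ≠ 0 with hS
  by_contra! hlt
  let r : V →ₗ[F] (S → F) := (LinearMap.funLeft F F (Subtype.val : S → X)).comp V.subtype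
  obtain ⟨⟨w, hw⟩, hwr, hw0⟩ := (Submodule.ne_bot_iff _).1
    (LinearMap.ker_ne_bot_of_finrank_lt (f := r) (by simpa using hlt))
  have hwS : ∀ x, v x ≠ 0 → w x = 0 := fun x hx =>
    congrFun (LinearMap.mem_ker.1 hwr) ⟨x, by simpa [hS] using hx⟩
  obtain ⟨x, hx⟩ : ∃ x, w x ≠ 0 := by
    by_contra! h
    exact hw0 (Subtype.ext (funext h))
  have hss : S ⊂ Finset.univ.filter fun x => (v + w) x ≠ 0 := by
    refine (Finset.ssubset_iff_of_subset ?_).2 ⟨x, ?_, ?_⟩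
    · intro y hy
      have hy' : v y ≠ 0 := by simpa [hS] using hy
      simpa [hwS y hy'] using hy'
    · have : v x = 0 := by_contra fun h => hx (hwS x h)
      simpa [this] using hx
    · have : v x = 0 := by_contra fun h => hx (hwS x h)
      simp [hS, this]
  have hcard := Finset.card_lt_card hss
  exact absurd (hmax ⟨v + w, V.add_mem hv hw, rfl⟩ hcard.le) (not_le.2 hcard)

/-- If the diagonal tensor on `X` is a combination of products `φ a x * φ b y * φ c z`, each having
a factor indexed by `L`, then `X` has at most `3 * #L` elements (Tao's slice rank lemma). -/
theorem card_le_three_mul_of_diagonal_eq_sum {F X ι : Type*} [Field F] [Fintype X] [DecidableEq X]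
    [Fintype ι] (φ : ι → X → F) (κ : ι → ι → ι → F) (L : Finset ι)
    (hκ : ∀ a b c, κ a b c ≠ 0 → a ∈ L ∨ b ∈ L ∨ c ∈ L)
    (hdiag : ∀ x y z, ∑ a, ∑ b, ∑ c, κ a b c * (φ a x * φ b y * φ c z) =
      if x = y ∧ x = z then 1 else 0) :
    Fintype.card X ≤ 3 * L.card := by
  classical
  let r : (X → F) →ₗ[F] (L → F) := Matrix.mulVecLin (Matrix.of fun (a : L) x => φ a x)
  obtain ⟨h, hh, hcard⟩ := r.ker.exists_finrank_le_card_support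
  have hh0 : ∀ a ∈ L, ∑ x, φ a x * h x = 0 := fun a ha =>
    congrFun (LinearMap.mem_ker.1 hh) ⟨a, ha⟩
  have hrank := r.finrank_range_add_finrank_ker
  have hrange := Submodule.finrank_le r.range
  simp only [Module.finrank_fintype_fun_eq_card, Fintype.card_coe] at hrank hrange
  set S := Finset.univ.filter fun x => h x ≠ 0 with hS
  let d : ι → ι → F := fun b c => ∑ a, κ a b c * ∑ x, φ a x * h x
  have hd : ∀ b c, b ∉ L → c ∉ L → d b c = 0 := by
    intro b c hb hc
    refine Finset.sum_eq_zero fun a _ => ?_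
    by_cases ha : a ∈ L
    · rw [hh0 a ha, mul_zero]
    · have : κ a b c = 0 := by
        by_contra hne
        rcases hκ a b c hne with h | h | h <;> contradiction
      rw [this, zero_mul]
  have hdφ : ∀ y z, ∑ b, ∑ c, d b c * (φ b y * φ c z) = if y = z then h y else 0 := by
    intro y z
    calc ∑ b, ∑ c, d b c * (φ b y * φ c z)
        = ∑ b, ∑ c, ∑ a, ∑ x, h x * (κ a b c * (φ a x * φ b y * φ c z)) := by
          refine Finset.sum_congr rfl fun b _ => Finset.sum_congr rfl fun c _ => ?_
          simp only [d, Finset.sum_mul, Finset.mul_sum]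
          refine Finset.sum_congr rfl fun a _ => Finset.sum_congr rfl fun x _ => ?_
          ring
      _ = ∑ x, h x * ∑ a, ∑ b, ∑ c, κ a b c * (φ a x * φ b y * φ c z) := by
          simp only [Finset.mul_sum]
          rw [Finset.sum_comm' (t' := Finset.univ) (s' := fun _ => Finset.univ) (by simp)]
          simp_rw [Finset.sum_comm (s := (Finset.univ : Finset ι)) (t := (Finset.univ : Finset X))]
          refine Finset.sum_congr rfl fun x _ => ?_
          rw [Finset.sum_comm]
          simp_rw [Finset.sum_comm (f := fun c a => h x * (κ a _ c * (φ a x * φ _ y * φ c z)))]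
          rw [Finset.sum_comm]
      _ = if y = z then h y else 0 := by
          simp only [hdiag]
          by_cases hyz : y = z
          · subst hyz
            simp
          · rw [if_neg hyz]
            refine Finset.sum_eq_zero fun x _ => ?_
            rw [if_neg (fun hx => hyz (hx.1.symm.trans hx.2)), mul_zero]
  let m : (S → F) →ₗ[F] (L → F) × (L → F) :=
    (Matrix.mulVecLin (Matrix.of fun (c : L) (z : S) => φ c z)).prod
      (Matrix.mulVecLin (Matrix.of fun (b : L) (z : S) => ∑ c, d b c * φ c z))
  have hm : Function.Injective m := by
    rw [← LinearMap.ker_eq_bot, LinearMap.ker_eq_bot']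
    intro w hw
    have h1 : ∀ c ∈ L, ∑ z : S, φ c z * w z = 0 := fun c hc =>
      congrFun (congrArg Prod.fst hw) ⟨c, hc⟩
    have h2 : ∀ b ∈ L, ∑ z : S, (∑ c, d b c * φ c z) * w z = 0 := fun b hb =>
      congrFun (congrArg Prod.snd hw) ⟨b, hb⟩
    have h3 : ∀ b, ∑ z : S, (∑ c, d b c * φ c z) * w z = 0 := by
      intro b
      by_cases hb : b ∈ L
      · exact h2 b hb
      simp only [Finset.sum_mul]
      rw [Finset.sum_comm]
      refine Finset.sum_eq_zero fun c _ => ?_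
      by_cases hc : c ∈ L
      · simp only [mul_assoc, ← Finset.mul_sum, h1 c hc, mul_zero]
      · simp [hd b c hb hc]
    funext y
    have hy : h y ≠ 0 := (Finset.mem_filter.1 y.2).2
    have key : h y * w y = ∑ b, φ b y * ∑ z : S, (∑ c, d b c * φ c z) * w z := by
      calc h y * w y = ∑ z : S, (∑ b, ∑ c, d b c * (φ b y * φ c z)) * w z := by
            simp [hdφ]
        _ = _ := by
            simp only [Finset.sum_mul, Finset.mul_sum]
            rw [Finset.sum_comm]
            refine Finset.sum_congr rfl fun b _ => Finset.sum_congr rfl fun z _ =>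
              Finset.sum_congr rfl fun c _ => ?_
            ring
    simp only [h3, mul_zero, Finset.sum_const_zero] at key
    exact (mul_eq_zero.1 key).resolve_left hy
  have hS2 := LinearMap.finrank_le_finrank_of_injective hm
  simp only [Module.finrank_prod, Module.finrank_fintype_fun_eq_card, Fintype.card_coe] at hS2
  omega

/-- `1 - (αx + βy + γz) ^ m` is a combination of monomials of degree at most `m`. -/
theorem exists_one_sub_pow_eq_sum {F : Type*} [Field F] (α β γ : F) (m : ℕ) :
    ∃ κ : Fin (m + 1) → Fin (m + 1) → Fin (m + 1) → F,
      (∀ a b c, κ a b c ≠ 0 → (a + b + c : ℕ) ≤ m) ∧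
      ∀ x y z : F, 1 - (α * x + β * y + γ * z) ^ m =
        ∑ a, ∑ b, ∑ c, κ a b c * (x ^ (a : ℕ) * y ^ (b : ℕ) * z ^ (c : ℕ)) := by
  refine ⟨fun a b c => (if a = 0 ∧ b = 0 ∧ c = 0 then 1 else 0) -
    if (a + b + c : ℕ) = m then
      (m.choose a * (m - a).choose b : ℕ) * (α ^ (a : ℕ) * β ^ (b : ℕ) * γ ^ (c : ℕ)) else 0,
    ?_, ?_⟩
  · intro a b c h
    by_contra! hlt
    refine h ?_
    dsimp only
    rw [if_neg, if_neg hlt.ne', sub_zero]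
    rintro ⟨rfl, rfl, rfl⟩
    simp at hlt
  · intro x y z
    simp only [sub_mul, Finset.sum_sub_distrib]
    congr 1
    · rw [Finset.sum_eq_single 0, Finset.sum_eq_single 0, Finset.sum_eq_single 0] <;>
        simp +contextual
    · rw [add_assoc, add_pow, ← Fin.sum_univ_eq_sum_range
        (fun a => (α * x) ^ a * (β * y + γ * z) ^ (m - a) * (m.choose a : F))]
      refine Finset.sum_congr rfl fun a _ => ?_
      have ha : (a : ℕ) ≤ m := Nat.lt_succ_iff.1 a.2
      have hext : (β * y + γ * z) ^ (m - (a : ℕ)) = ∑ b ∈ Finset.range (m + 1),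
          (β * y) ^ b * (γ * z) ^ (m - a - b) * ((m - a).choose b : F) := by
        rw [add_pow]
        refine Finset.sum_subset (Finset.range_mono (by omega)) fun b _ hb => ?_
        rw [Nat.choose_eq_zero_of_lt (by simpa using hb), Nat.cast_zero, mul_zero]
      rw [hext, ← Fin.sum_univ_eq_sum_range
        (fun b => (β * y) ^ b * (γ * z) ^ (m - a - b) * ((m - a).choose b : F)),
        Finset.mul_sum, Finset.sum_mul]
      refine Finset.sum_congr rfl fun b _ => ?_
      by_cases hb : (a + b : ℕ) ≤ m
      · rw [Finset.sum_eq_single ⟨m - a - b, by omega⟩]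
        · rw [if_pos (by simp; omega)]
          push_cast
          ring
        · intro c _ hc
          rw [if_neg, zero_mul]
          intro h
          exact hc (Fin.ext (by simp; omega))
        · simp
      · rw [Nat.choose_eq_zero_of_lt (by omega : m - (a : ℕ) < b)]
        simp

theorem exists_geom_sum_cube_lt (m : ℕ) (hm : 0 < m) :
    ∃ s : ℝ, 0 < s ∧ s < 1 ∧ ∑ j : Fin (m + 1), s ^ (3 * (j : ℕ)) < (m + 1) * s ^ m := by
  let f : ℝ → ℝ := fun s => ∑ j : Fin (m + 1), s ^ (3 * (j : ℕ)) - (m + 1) * s ^ m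
  have hgauss : ∑ j : Fin (m + 1), (j : ℝ) = m * (m + 1) / 2 := by
    rw [Fin.sum_univ_eq_sum_range (fun j => (j : ℝ))]
    clear hm f
    induction m with
    | zero => simp
    | succ k ih =>
      rw [Finset.sum_range_succ, ih]
      push_cast
      ring
  have hf : HasDerivAt f ((m : ℝ) * (m + 1) / 2) 1 := by
    have h := (HasDerivAt.fun_sum (u := Finset.univ) fun (j : Fin (m + 1)) _ =>
      hasDerivAt_pow (3 * (j : ℕ)) (1 : ℝ)).sub ((hasDerivAt_pow m (1 : ℝ)).const_mul (m + 1 : ℝ))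
    refine HasDerivAt.congr_deriv (f := f) h ?_
    simp only [one_pow, mul_one, Nat.cast_mul, Nat.cast_ofNat, ← Finset.mul_sum, hgauss]
    ring
  have hf1 : f 1 = 0 := by simp [f]
  have hpos : (0 : ℝ) < m * (m + 1) / 2 := by positivity
  have hslope := (hasDerivAt_iff_tendsto_slope.1 hf).eventually (lt_mem_nhds hpos)
  have hleft := hslope.filter_mono (nhdsWithin_mono 1 fun x (hx : x ∈ Set.Iio (1 : ℝ)) => hx.ne)
  obtain ⟨s, ⟨hs, hs1⟩, hs0⟩ := ((hleft.and self_mem_nhdsWithin).and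
    (nhdsWithin_le_nhds (lt_mem_nhds (zero_lt_one' ℝ)))).exists
  refine ⟨s, hs0, hs1, ?_⟩
  rw [slope_def_field, hf1, sub_zero] at hs
  have hs1' : s - 1 < 0 := sub_neg.2 hs1
  have : f s < 0 := by
    by_contra! h
    exact absurd hs (not_lt.2 (div_nonpos_of_nonneg_of_nonpos h hs1'.le))
  exact sub_neg.1 this

/-- Chernoff bound for the number of exponent vectors of small total degree. -/
theorem card_filter_three_mul_sum_le (m n : ℕ) {s : ℝ} (hs0 : 0 < s) (hs1 : s ≤ 1) :
    ((Finset.univ.filter fun a : Fin n → Fin (m + 1) => 3 * ∑ i, (a i : ℕ) ≤ n * m).card : ℝ) ≤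
      ((∑ j : Fin (m + 1), s ^ (3 * (j : ℕ))) / s ^ m) ^ n := by
  rw [div_pow, le_div_iff₀ (by positivity), ← nsmul_eq_mul, ← Finset.sum_const]
  calc _ ≤ ∑ a ∈ Finset.univ.filter fun a : Fin n → Fin (m + 1) => 3 * ∑ i, (a i : ℕ) ≤ n * m,
        ∏ i, s ^ (3 * (a i : ℕ)) := by
        refine Finset.sum_le_sum fun a ha => ?_
        rw [Finset.prod_pow_eq_pow_sum, ← Finset.mul_sum, ← pow_mul, mul_comm m n]
        exact pow_le_pow_of_le_one hs0.le hs1 (Finset.mem_filter.1 ha).2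
    _ ≤ ∑ a : Fin n → Fin (m + 1), ∏ i, s ^ (3 * (a i : ℕ)) :=
        Finset.sum_le_sum_of_subset_of_nonneg (Finset.filter_subset _ _) fun a _ _ =>
          Finset.prod_nonneg fun i _ => (pow_pos hs0 _).le
    _ = _ := by
        rw [← Fintype.prod_sum (fun (_ : Fin n) (j : Fin (m + 1)) => s ^ (3 * (j : ℕ)))]
        simp

theorem FiniteField.prod_one_sub_pow_eq_ite {F ι : Type*} [Field F] [Fintype F] [DecidableEq F]
    [Fintype ι] {m : ℕ} (hm : Fintype.card F = m + 1) (u : ι → F) :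
    ∏ i, (1 - u i ^ m) = if u = 0 then 1 else 0 := by
  have hm' : m ≠ 0 := by
    have := Fintype.one_lt_card (α := F)
    omega
  split_ifs with h
  · simp [h, hm']
  · obtain ⟨i, hi⟩ := Function.ne_iff.1 h
    refine Finset.prod_eq_zero (Finset.mem_univ i) ?_
    have := FiniteField.pow_card_sub_one_eq_one (u i) hi
    rw [hm, Nat.add_sub_cancel] at this
    rw [this, sub_self]

theorem card_le_three_mul_card_filter {F : Type*} [Field F] [Fintype F] {m : ℕ}
    (hm : Fintype.card F = m + 1) {n : ℕ} {α β γ : F} (hsum : α + β + γ = 0)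
    (A : Finset (Fin n → F))
    (hA : ∀ a₁ ∈ A, ∀ a₂ ∈ A, ∀ a₃ ∈ A,
      α • a₁ + β • a₂ + γ • a₃ = 0 → a₁ = a₂ ∧ a₁ = a₃) :
    A.card ≤ 3 *
      (Finset.univ.filter fun a : Fin n → Fin (m + 1) => 3 * ∑ i, (a i : ℕ) ≤ n * m).card := by
  classical
  obtain ⟨κ, hκ, hexp⟩ := exists_one_sub_pow_eq_sum α β γ m
  rw [← Fintype.card_coe A]
  refine card_le_three_mul_of_diagonal_eq_sum (fun a (x : A) => ∏ i, (x : Fin n → F) i ^ (a i : ℕ))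
    (fun a b c => ∏ i, κ (a i) (b i) (c i)) _ ?_ ?_
  · intro a b c h
    have hle : ∑ i, (a i + b i + c i : ℕ) ≤ ∑ _i : Fin n, m := Finset.sum_le_sum fun i _ =>
      hκ _ _ _ (Finset.prod_ne_zero_iff.1 h i (Finset.mem_univ i))
    simp only [Finset.sum_add_distrib, Finset.sum_const, Finset.card_univ, Fintype.card_fin,
      smul_eq_mul] at hle
    simp only [Finset.mem_filter, Finset.mem_univ, true_and]
    omega
  · intro x y z
    calc _ = ∏ i, (1 - (α • (x : Fin n → F) + β • (y : Fin n → F) + γ • (z : Fin n → F)) i ^ m) := by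
          simp only [Pi.add_apply, Pi.smul_apply, smul_eq_mul, hexp, Fintype.prod_sum,
            Finset.prod_mul_distrib]
      _ = _ := by
          rw [FiniteField.prod_one_sub_pow_eq_ite hm]
          refine if_congr ⟨fun h => ?_, ?_⟩ rfl rfl
          · have := hA x x.2 y y.2 z z.2 h
            exact ⟨Subtype.ext this.1, Subtype.ext this.2⟩
          · rintro ⟨rfl, rfl⟩
            rw [← add_smul, ← add_smul, hsum, zero_smul]

/-- General cap set theorem: over any finite field `F` with `q` elements there are constants
`B > 0` and `0 < C < q` bounding the size of any generalized cap set in `Fⁿ` by `B * Cⁿ`. -/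
theorem general_cap_set (F : Type) [Field F] [Fintype F] :
    ∃ B C : ℝ, 0 < B ∧ 0 < C ∧ C < Fintype.card F ∧
      ∀ (n : ℕ), 0 < n → ∀ (α β γ : F), γ ≠ 0 → α + β + γ = 0 →
        ∀ (A : Finset (Fin n → F)),
          (∀ a₁ ∈ A, ∀ a₂ ∈ A, ∀ a₃ ∈ A,
            α • a₁ + β • a₂ + γ • a₃ = 0 → a₁ = a₂ ∧ a₁ = a₃) →
          (A.card : ℝ) ≤ B * C ^ n := by
  obtain ⟨m, hm⟩ : ∃ m, Fintype.card F = m + 1 :=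
    Nat.exists_eq_add_one_of_ne_zero Fintype.card_ne_zero
  have hm0 : 0 < m := by
    have := Fintype.one_lt_card (α := F)
    omega
  obtain ⟨s, hs0, hs1, hs⟩ := exists_geom_sum_cube_lt m hm0
  refine ⟨3, (∑ j : Fin (m + 1), s ^ (3 * (j : ℕ))) / s ^ m, by norm_num, by positivity, ?_, ?_⟩
  · rw [div_lt_iff₀ (by positivity), hm]
    exact_mod_cast hs
  · intro n _ α β γ _ hsum A hA
    refine (Nat.cast_le.2 (card_le_three_mul_card_filter hm hsum A hA)).trans ?_
    rw [Nat.cast_mul, Nat.cast_ofNat]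
    gcongr
    exact card_filter_three_mul_sum_le m n hs0 hs1.le
end

section
/- Let n be a positive integer and let A ⊆ (ℤ/3ℤ)^n be a finite set such that for all x, y, z ∈ A, if x + y + z = 0 then x = y and x = z. Then |A| ≤ 3·c^n, where c := ((3/8)^3 · (207 + 33·√33))^(1/3). In particular, since c < 2.755105, the maximal size of such a set is o(2.755105^n). -/
open Finset Matrix

/-- A subspace of `α → F` contains a vector whose support is at least as large as the dimension
of the subspace. -/
theorem exists_mem_finrank_le_card_support {F α : Type*} [Field F] [DecidableEq F] [Fintype α]
    (W : Submodule F (α → F)) :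
    ∃ h ∈ W, Module.finrank F W ≤ #{x | h x ≠ 0} := by
  obtain ⟨h, hW, hmax⟩ : ∃ h ∈ W, ∀ w ∈ W, #{x | w x ≠ 0} ≤ #{x | h x ≠ 0} := by
    have hbdd : BddAbove {k | ∃ w ∈ W, #{x | w x ≠ 0} = k} :=
      ⟨Fintype.card α, by rintro _ ⟨w, -, rfl⟩; exact card_le_univ _⟩
    obtain ⟨h, hW, hk⟩ := Nat.sSup_mem (by exact ⟨_, 0, W.zero_mem, rfl⟩) hbdd
    exact ⟨h, hW, fun w hw => hk ▸ le_csSup hbdd ⟨w, hw, rfl⟩⟩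
  refine ⟨h, hW, ?_⟩
  let S : Finset α := {x | h x ≠ 0}
  let restr : W →ₗ[F] (S → F) := (LinearMap.funLeft F F (Subtype.val : S → α)).comp W.subtype
  have hinj : Function.Injective restr := by
    rw [← LinearMap.ker_eq_bot, LinearMap.ker_eq_bot']
    rintro ⟨w, hw⟩ hres
    have hwS : ∀ x, h x ≠ 0 → w x = 0 := fun x hx =>
      congrFun hres (⟨x, by simpa [S] using hx⟩ : S)
    ext y
    by_contra hy
    change w y ≠ 0 at hy
    have hhy : h y = 0 := by_contra fun hne => hy (hwS y hne)
    refine (hmax (h + w) (W.add_mem hW hw)).not_gt (card_lt_card ?_)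
    refine (ssubset_iff_of_subset fun x hx => ?_).2 ⟨y, by simpa [hhy] using hy, by simpa using hhy⟩
    have hx' : h x ≠ 0 := by simpa using hx
    simpa [hwS x hx'] using hx'
  have hfin := LinearMap.finrank_le_finrank_of_injective hinj
  rwa [Module.finrank_fintype_fun_eq_card, Fintype.card_coe] at hfin

/-- The diagonal tensor on `α × α × α` is not a sum of fewer than `card α` slices. -/
theorem card_le_of_diagonal_eq_sum_slices {F α I J K : Type*} [Field F] [Fintype α]
    [DecidableEq α] [Fintype I] [Fintype J] [Fintype K]
    (f : I → α → F) (f' : I → α → α → F) (g : J → α → F) (g' : J → α → α → F)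
    (k : K → α → F) (k' : K → α → α → F)
    (hsum : ∀ x y z, (if x = y ∧ x = z then (1 : F) else 0) =
      ∑ i, f i x * f' i y z + ∑ j, g j y * g' j x z + ∑ l, k l z * k' l x y) :
    Fintype.card α ≤ Fintype.card I + Fintype.card J + Fintype.card K := by
  classical
  let φ : (α → F) →ₗ[F] (I → F) := Matrix.mulVecLin (Matrix.of f)
  obtain ⟨h, hker, hcard⟩ := exists_mem_finrank_le_card_support (LinearMap.ker φ)
  have hdim : Fintype.card α ≤ Fintype.card I + Module.finrank F (LinearMap.ker φ) := by
    have h₁ := φ.finrank_range_add_finrank_ker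
    have h₂ := Submodule.finrank_le (LinearMap.range φ)
    simp only [Module.finrank_fintype_fun_eq_card] at h₁ h₂
    omega
  have horth : ∀ i, ∑ x, h x * f i x = 0 := fun i => by
    have := congrFun (LinearMap.mem_ker.1 hker) i
    simpa [φ, Matrix.mulVec, dotProduct, mul_comm] using this
  have hdiag : Matrix.diagonal h =
      (Matrix.of fun y j => g j y) * (Matrix.of fun j z => ∑ x, h x * g' j x z) +
      (Matrix.of fun y l => ∑ x, h x * k' l x y) * Matrix.of k := by
    ext y z
    have hz : ∑ x, h x * (if x = y ∧ x = z then (1 : F) else 0) = Matrix.diagonal h y z := by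
      rw [sum_eq_single y (fun x _ hx => by simp [hx]) (by simp)]
      by_cases hyz : y = z <;> simp [hyz]
    have hI : ∑ x, h x * ∑ i, f i x * f' i y z = 0 := by
      simp_rw [mul_sum]
      rw [sum_comm]
      refine sum_eq_zero fun i _ => ?_
      simp_rw [← mul_assoc]
      rw [← sum_mul, horth, zero_mul]
    rw [← hz]
    simp_rw [hsum, mul_add, sum_add_distrib, hI, zero_add]
    simp only [Matrix.add_apply, Matrix.mul_apply, Matrix.of_apply, mul_sum, sum_mul]
    congr 1
    · rw [sum_comm]
      exact sum_congr rfl fun _ _ => sum_congr rfl fun _ _ => by ring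
    · rw [sum_comm]
      exact sum_congr rfl fun _ _ => sum_congr rfl fun _ _ => by ring
  have hrank : #{x | h x ≠ 0} ≤ Fintype.card J + Fintype.card K := by
    have hr := Matrix.rank_diagonal h
    rw [Fintype.card_subtype] at hr
    rw [← hr, hdiag, ← Matrix.fromCols_mul_fromRows, ← Fintype.card_sum]
    exact (Matrix.rank_mul_le_left _ _).trans (Matrix.rank_le_card_width _)
  omega

/-- The exponent vectors in `{0, 1, 2}ⁿ` of total degree at most `2n/3`. -/
def lowDegree (n : ℕ) : Finset (Fin n → Fin 3) := {a | 3 * ∑ i, (a i : ℕ) ≤ 2 * n}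

theorem card_lowDegree_mul_pow_le (n : ℕ) {s : ℝ} (hs₀ : 0 ≤ s) (hs₁ : s ≤ 1) :
    (#(lowDegree n) : ℝ) * (s ^ 2) ^ n ≤ (1 + s ^ 3 + s ^ 6) ^ n := by
  calc (#(lowDegree n) : ℝ) * (s ^ 2) ^ n = ∑ a ∈ lowDegree n, s ^ (2 * n) := by
        rw [sum_const, nsmul_eq_mul, pow_mul]
    _ ≤ ∑ a ∈ lowDegree n, s ^ (3 * ∑ i, (a i : ℕ)) :=
        sum_le_sum fun a ha => pow_le_pow_of_le_one hs₀ hs₁ (by simpa [lowDegree] using ha)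
    _ ≤ ∑ a : Fin n → Fin 3, s ^ (3 * ∑ i, (a i : ℕ)) :=
        sum_le_sum_of_subset_of_nonneg (subset_univ _) fun _ _ _ => by positivity
    _ = ∏ _i : Fin n, ∑ j : Fin 3, (s ^ 3) ^ (j : ℕ) := by
        rw [Fintype.prod_sum]
        simp_rw [pow_mul, prod_pow_eq_pow_sum]
    _ = (1 + s ^ 3 + s ^ 6) ^ n := by
        simp [Fin.sum_univ_three, ← pow_mul]

/-- The coefficient of `x ^ a * y ^ b * z ^ c` in `1 - (x + y + z) ^ 2`. -/
def lineCoeff (a b c : Fin 3) : ZMod 3 :=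
  if (a : ℕ) + b + c = 0 then 1
  else if (a : ℕ) + b + c = 2 then (if a = 2 ∨ b = 2 ∨ c = 2 then -1 else -2) else 0

theorem add_le_two_of_lineCoeff_ne_zero {a b c : Fin 3} (h : lineCoeff a b c ≠ 0) :
    (a : ℕ) + b + c ≤ 2 := by
  unfold lineCoeff at h
  split_ifs at h <;> first | omega | exact absurd rfl h

theorem sum_lineCoeff (x y z : ZMod 3) :
    ∑ p : Fin 3 × Fin 3 × Fin 3,
      lineCoeff p.1 p.2.1 p.2.2 * (x ^ (p.1 : ℕ) * y ^ (p.2.1 : ℕ) * z ^ (p.2.2 : ℕ)) =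
      if x + y + z = 0 then 1 else 0 := by
  revert x y z
  decide

/-- The monomial with exponent vector `a`, as a function on `(ℤ/3ℤ)ⁿ`. -/
def monomialFun {n : ℕ} (a : Fin n → Fin 3) (x : Fin n → ZMod 3) : ZMod 3 :=
  ∏ i, x i ^ (a i : ℕ)

/-- The coefficient of `xᵃ yᵇ zᶜ` in `∏ i, (1 - (x i + y i + z i) ^ 2)`. -/
def lineCoeffs {n : ℕ} (a b c : Fin n → Fin 3) : ZMod 3 := ∏ i, lineCoeff (a i) (b i) (c i)

theorem ite_add_eq_zero_eq_sum {n : ℕ} (x y z : Fin n → ZMod 3) :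
    (if x + y + z = 0 then (1 : ZMod 3) else 0) =
      ∑ a, ∑ b, ∑ c, lineCoeffs a b c * (monomialFun a x * monomialFun b y * monomialFun c z) := by
  have hprod : (if x + y + z = 0 then (1 : ZMod 3) else 0) =
      ∏ i, if x i + y i + z i = 0 then (1 : ZMod 3) else 0 := by
    simp [prod_ite_zero, funext_iff]
  rw [hprod]
  simp_rw [← sum_lineCoeff]
  rw [Fintype.prod_sum]
  let e : (Fin n → Fin 3 × Fin 3 × Fin 3) ≃
      (Fin n → Fin 3) × (Fin n → Fin 3) × (Fin n → Fin 3) :=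
    (Equiv.arrowProdEquivProdArrow _ _ _).trans
      ((Equiv.refl _).prodCongr (Equiv.arrowProdEquivProdArrow _ _ _))
  rw [Fintype.sum_equiv e _ (fun q => lineCoeffs q.1 q.2.1 q.2.2 *
    (monomialFun q.1 x * monomialFun q.2.1 y * monomialFun q.2.2 z))]
  · simp_rw [Fintype.sum_prod_type]
  · intro p
    simp only [lineCoeffs, monomialFun, ← prod_mul_distrib]
    rfl

theorem mem_lowDegree_of_lineCoeffs_ne_zero {n : ℕ} {a b c : Fin n → Fin 3}
    (h : lineCoeffs a b c ≠ 0) : a ∈ lowDegree n ∨ b ∈ lowDegree n ∨ c ∈ lowDegree n := by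
  have hsum : ∑ i, ((a i : ℕ) + b i + c i) ≤ ∑ _i : Fin n, 2 :=
    sum_le_sum fun i hi => add_le_two_of_lineCoeff_ne_zero (prod_ne_zero_iff.1 h i hi)
  simp only [sum_add_distrib, sum_const, card_univ, Fintype.card_fin, smul_eq_mul] at hsum
  simp only [lowDegree, mem_filter, mem_univ, true_and]
  omega

theorem lineCoeffs_eq_add {n : ℕ} (a b c : Fin n → Fin 3) :
    lineCoeffs a b c = (if a ∈ lowDegree n then lineCoeffs a b c else 0) +
      (if b ∈ lowDegree n then (if a ∉ lowDegree n then lineCoeffs a b c else 0) else 0) +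
      (if c ∈ lowDegree n then
        (if a ∉ lowDegree n ∧ b ∉ lowDegree n then lineCoeffs a b c else 0) else 0) := by
  by_cases h : lineCoeffs a b c = 0
  · simp [h]
  · have := mem_lowDegree_of_lineCoeffs_ne_zero h
    by_cases ha : a ∈ lowDegree n <;> by_cases hb : b ∈ lowDegree n <;>
      by_cases hc : c ∈ lowDegree n <;> simp_all

theorem card_le_three_mul_card_lowDegree {n : ℕ} (A : Finset (Fin n → ZMod 3))
    (hA : ∀ x ∈ A, ∀ y ∈ A, ∀ z ∈ A, x + y + z = 0 → x = y ∧ x = z) :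
    #A ≤ 3 * #(lowDegree n) := by
  have key := card_le_of_diagonal_eq_sum_slices (F := ZMod 3) (α := A)
    (I := lowDegree n) (J := lowDegree n) (K := lowDegree n)
    (fun a x => monomialFun a.1 x.1)
    (fun a y z => ∑ b, ∑ c, lineCoeffs a.1 b c * (monomialFun b y.1 * monomialFun c z.1))
    (fun b y => monomialFun b.1 y.1)
    (fun b x z => ∑ a, ∑ c, (if a ∉ lowDegree n then lineCoeffs a b.1 c else 0) *
      (monomialFun a x.1 * monomialFun c z.1))
    (fun c z => monomialFun c.1 z.1)
    (fun c x y => ∑ a, ∑ b,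
      (if a ∉ lowDegree n ∧ b ∉ lowDegree n then lineCoeffs a b c.1 else 0) *
      (monomialFun a x.1 * monomialFun b y.1)) ?_
  · simp only [Fintype.card_coe] at key
    omega
  rintro ⟨x, hx⟩ ⟨y, hy⟩ ⟨z, hz⟩
  have hiff : x = y ∧ x = z ↔ x + y + z = 0 := by
    refine ⟨?_, hA x hx y hy z hz⟩
    rintro ⟨rfl, rfl⟩
    ext i
    have : ∀ t : ZMod 3, t + t + t = 0 := by decide
    exact this (x i)
  simp only [Subtype.mk.injEq, hiff]
  rw [ite_add_eq_zero_eq_sum]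
  simp_rw [fun a b c => congrArg
    (· * (monomialFun a x * monomialFun b y * monomialFun c z)) (lineCoeffs_eq_add a b c)]
  simp_rw [add_mul, sum_add_distrib]
  have hsub : ∀ G : (Fin n → Fin 3) → ZMod 3,
      ∑ a : lowDegree n, G a = ∑ a, if a ∈ lowDegree n then G a else 0 := fun G => by
    rw [sum_coe_sort (lowDegree n) G, ← sum_filter, filter_univ_mem]
  congr 1
  · congr 1
    · rw [hsub fun a => monomialFun a x *
        ∑ b, ∑ c, lineCoeffs a b c * (monomialFun b y * monomialFun c z)]
      refine sum_congr rfl fun a _ => ?_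
      split_ifs
      · simp_rw [mul_sum]
        exact sum_congr rfl fun _ _ => sum_congr rfl fun _ _ => by ring
      · simp
    · rw [hsub fun b => monomialFun b y *
        ∑ a, ∑ c, (if a ∉ lowDegree n then lineCoeffs a b c else 0) *
          (monomialFun a x * monomialFun c z), sum_comm]
      refine sum_congr rfl fun b _ => ?_
      by_cases hb : b ∈ lowDegree n
      · simp only [hb, if_true, mul_sum]
        exact sum_congr rfl fun _ _ => sum_congr rfl fun _ _ => by ring
      · simp [hb]
  · rw [hsub fun c => monomialFun c z *
      ∑ a, ∑ b, (if a ∉ lowDegree n ∧ b ∉ lowDegree n then lineCoeffs a b c else 0) *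
        (monomialFun a x * monomialFun b y)]
    simp_rw [fun a => sum_comm (s := (univ : Finset (Fin n → Fin 3)))
      (t := (univ : Finset (Fin n → Fin 3))) (f := fun b c =>
        (if c ∈ lowDegree n then
          (if a ∉ lowDegree n ∧ b ∉ lowDegree n then lineCoeffs a b c else 0) else 0) *
        (monomialFun a x * monomialFun b y * monomialFun c z))]
    rw [sum_comm]
    refine sum_congr rfl fun c _ => ?_
    by_cases hc : c ∈ lowDegree n
    · simp only [hc, if_true, mul_sum]
      exact sum_congr rfl fun _ _ => sum_congr rfl fun _ _ => by ring
    · simp [hc]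

/-- The constant of the cap set bound is the value of `(1 + s³ + s⁶) / s²` at `s³ = (√33 - 1) / 8`. -/
theorem exists_capConstant_eq :
    ∃ s : ℝ, 0 < s ∧ s ≤ 1 ∧
      ((3/8 : ℝ)^3 * (207 + 33 * Real.sqrt 33)) ^ ((1:ℝ)/3) = (1 + s ^ 3 + s ^ 6) / s ^ 2 := by
  have hsq : Real.sqrt 33 ^ 2 = 33 := Real.sq_sqrt (by norm_num)
  have h₁ : 1 < Real.sqrt 33 := Real.lt_sqrt_of_sq_lt (by norm_num)
  have h₉ : Real.sqrt 33 ≤ 9 := Real.sqrt_le_iff.2 (by norm_num)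
  have ht₀ : 0 < (Real.sqrt 33 - 1) / 8 := by linarith
  set s : ℝ := ((Real.sqrt 33 - 1) / 8) ^ ((1:ℝ)/3) with hs
  have hs₀ : 0 < s := Real.rpow_pos_of_pos ht₀ _
  have hs₁ : s ≤ 1 := Real.rpow_le_one ht₀.le (by linarith) (by norm_num)
  have hs₃ : s ^ 3 = (Real.sqrt 33 - 1) / 8 := by
    rw [hs, ← Real.rpow_natCast, ← Real.rpow_mul ht₀.le]
    norm_num
  refine ⟨s, hs₀, hs₁, ?_⟩
  have hcube : (3/8 : ℝ)^3 * (207 + 33 * Real.sqrt 33) = ((1 + s ^ 3 + s ^ 6) / s ^ 2) ^ 3 := by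
    have h₆ : s ^ 6 = (s ^ 3) ^ 2 := by ring
    have h₂ : (s ^ 2) ^ 3 = (s ^ 3) ^ 2 := by ring
    rw [div_pow (1 + s ^ 3 + s ^ 6), h₂, eq_div_iff (by positivity), h₆, hs₃]
    generalize Real.sqrt 33 = r at hsq
    have h3 : r ^ 3 = 33 * r := by rw [pow_succ, hsq]
    have h4 : r ^ 4 = 1089 := by rw [show r ^ 4 = (r ^ 2) ^ 2 by ring, hsq]; norm_num
    have h5 : r ^ 5 = 1089 * r := by rw [pow_succ, h4]
    have h6 : r ^ 6 = 35937 := by rw [show r ^ 6 = (r ^ 2) ^ 3 by ring, hsq]; norm_num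
    ring_nf
    rw [h6, h5, h4, h3, hsq]
    ring
  rw [hcube, ← Real.rpow_natCast, ← Real.rpow_mul (by positivity)]
  norm_num

theorem capConstant_lt :
    ((3/8 : ℝ)^3 * (207 + 33 * Real.sqrt 33)) ^ ((1:ℝ)/3) < 2.755105 := by
  have hsqrt : Real.sqrt 33 < 5.744563 := (Real.sqrt_lt' (by norm_num)).2 (by norm_num)
  have hroot : ((2.755105 : ℝ) ^ 3) ^ ((1:ℝ)/3) = 2.755105 := by
    rw [← Real.rpow_natCast, ← Real.rpow_mul (by norm_num)]
    norm_num
  rw [← hroot]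
  refine Real.rpow_lt_rpow (by positivity) ?_ (by norm_num)
  norm_num at hsqrt ⊢
  linarith


/-- The cap set theorem: a cap set in `(ℤ/3ℤ)ⁿ` has size at most `3 * cⁿ` where
`c = ((3/8)³ * (207 + 33√33))^(1/3)`; moreover `c < 2.755105`, so the maximal size of a
cap set is `o(2.755105ⁿ)`. -/
theorem cap_set (n : ℕ) (hn : 0 < n) (A : Finset (Fin n → ZMod 3))
    (hA : ∀ x ∈ A, ∀ y ∈ A, ∀ z ∈ A, x + y + z = 0 → x = y ∧ x = z) :
    (A.card : ℝ) ≤ 3 * (((3/8 : ℝ)^3 * (207 + 33 * Real.sqrt 33)) ^ ((1:ℝ)/3)) ^ n ∧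
    ((3/8 : ℝ)^3 * (207 + 33 * Real.sqrt 33)) ^ ((1:ℝ)/3) < 2.755105 := by
  refine ⟨?_, capConstant_lt⟩
  obtain ⟨s, hs₀, hs₁, hc⟩ := exists_capConstant_eq
  have hcard : (A.card : ℝ) ≤ 3 * (#(lowDegree n) : ℝ) := by
    exact_mod_cast card_le_three_mul_card_lowDegree A hA
  rw [hc, div_pow]
  refine hcard.trans (mul_le_mul_of_nonneg_left ?_ (by norm_num))
  rw [le_div_iff₀ (by positivity)]
  exact card_lowDegree_mul_pow_le n hs₀.le hs₁
end

section
/- Let q be a prime power, F_q a finite field with q elements, n a positive integer, and r a real number with 0 < r < 1. Then m_{(q−1)n/3} ≤ (C_{r,q}² / (1 − r)) · C_{r,q}^n. -/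
attribute [local instance] Classical.propDecidable

/-- The set `M_n^d` of monomials in `n` variables over a finite field `F` whose exponents are
all at most `Fintype.card F - 1` and whose total degree is at most `d`. -/
noncomputable def capM (F : Type) [Field F] [Fintype F] (n : ℕ) (d : ℝ) :
    Finset (MvPolynomial (Fin n) F) :=
  (Finset.univ.filter
    (fun f : Fin n → Fin (Fintype.card F) => ((∑ i, (f i : ℕ) : ℕ) : ℝ) ≤ d)).image
    (fun f => MvPolynomial.monomial (Finsupp.equivFunOnFinite.symm fun i => ((f i : ℕ))) (1 : F))

/-- `m_d`, the cardinality of `M_n^d`. -/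
noncomputable def capm (F : Type) [Field F] [Fintype F] (n : ℕ) (d : ℝ) : ℕ :=
  (capM F n d).card

/-- The constant `C_{r,q} = (1 + r + ⋯ + r^{q-1}) / r^((q-1)/3)`. -/
noncomputable def Crq (r : ℝ) (q : ℕ) : ℝ :=
  (∑ k ∈ Finset.range q, r ^ k) / r ^ (((q : ℝ) - 1) / 3)

/-- Chernoff-type bound: the number of exponent vectors of total degree at most `d`, weighted by
`r ^ d`, is at most the generating function `(1 + r + ⋯ + r ^ (q - 1)) ^ n`. -/
theorem card_filter_sum_le_mul_rpow_le (q n : ℕ) (d r : ℝ) (hr : 0 < r) (hr1 : r ≤ 1) :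
    ((Finset.univ.filter
      (fun f : Fin n → Fin q => ((∑ i, (f i : ℕ) : ℕ) : ℝ) ≤ d)).card : ℝ) * r ^ d ≤
      (∑ k ∈ Finset.range q, r ^ k) ^ n := by
  have expand : (∑ k ∈ Finset.range q, r ^ k) ^ n =
      ∑ f : Fin n → Fin q, r ^ (∑ i, (f i : ℕ)) := by
    rw [← Fin.sum_univ_eq_sum_range, Fintype.sum_pow]
    simp only [Finset.prod_pow_eq_pow_sum]
  rw [expand, ← nsmul_eq_mul]
  refine (Finset.card_nsmul_le_sum _ (fun f => r ^ (∑ i, (f i : ℕ))) _ fun f hf => ?_).trans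
    (Finset.sum_le_sum_of_subset_of_nonneg (Finset.filter_subset _ _) fun _ _ _ => by positivity)
  rw [← Real.rpow_natCast]
  exact Real.rpow_le_rpow_of_exponent_ge hr hr1 (Finset.mem_filter.mp hf).2

theorem one_le_Crq (r : ℝ) (q : ℕ) (hq : 1 ≤ q) (hr : 0 < r) (hr1 : r ≤ 1) : 1 ≤ Crq r q := by
  have hq' : (1 : ℝ) ≤ q := by exact_mod_cast hq
  have hpow : r ^ (((q : ℝ) - 1) / 3) ≤ 1 :=
    Real.rpow_le_one hr.le hr1 (by linarith)
  have hsum : 1 ≤ ∑ k ∈ Finset.range q, r ^ k := by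
    simpa using Finset.single_le_sum (f := fun k => r ^ k) (fun k _ => by positivity)
      (Finset.mem_range.mpr hq)
  rw [Crq, one_le_div (Real.rpow_pos_of_pos hr _)]
  exact hpow.trans hsum

theorem capm_le_Crq_pow (F : Type) [Field F] [Fintype F] (n : ℕ) (r : ℝ) (hr : 0 < r)
    (hr1 : r ≤ 1) :
    (capm F n (((Fintype.card F : ℝ) - 1) * n / 3) : ℝ) ≤ Crq r (Fintype.card F) ^ n := by
  have hd : r ^ (((Fintype.card F : ℝ) - 1) * n / 3) =
      (r ^ (((Fintype.card F : ℝ) - 1) / 3)) ^ n := by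
    rw [← Real.rpow_mul_natCast hr.le]
    congr 1
    ring
  rw [Crq, div_pow, ← hd, le_div_iff₀ (Real.rpow_pos_of_pos hr _)]
  refine le_trans ?_ 
    (card_filter_sum_le_mul_rpow_le _ n (((Fintype.card F : ℝ) - 1) * n / 3) r hr hr1)
  gcongr
  exact Finset.card_image_le

/-- The earlier asymptotic estimate: `m_{(q-1)n/3} ≤ (C_{r,q}² / (1 - r)) ⬝ C_{r,q}ⁿ`
for any `0 < r < 1`. -/
theorem capm_le_const_mul_Crq_pow (F : Type) [Field F] [Fintype F] (n : ℕ) (hn : 0 < n)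
    (r : ℝ) (hr : 0 < r) (hr1 : r < 1) :
    (capm F n (((Fintype.card F : ℝ) - 1) * n / 3) : ℝ) ≤
      Crq r (Fintype.card F) ^ 2 / (1 - r) * Crq r (Fintype.card F) ^ n := by
  have hC := one_le_Crq r _ (Fintype.card_pos (α := F)) hr hr1.le
  refine (capm_le_Crq_pow F n r hr hr1.le).trans (le_mul_of_one_le_left (by positivity) ?_)
  rw [one_le_div (by linarith)]
  nlinarith
end
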